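/- arXiv:1205.3834 — 2 statements merged into one kernel-verified Lean document; each statement's English description precedes it below -/
import Mathlib

section
/- Let D ∈ ℂ^{m×d} and let T, T' ⊆ {1,…,m} be disjoint sets with |T| ≤ s and |T'| = s, such that ‖row_i(D)‖₂ ≤ ‖row_{i'}(D)‖₂ for every i ∈ T and i' ∈ T'. Then ‖D_T‖_{2,2} ≤ s^{−1/2} ‖D_{T'}‖_{1,2}. -/
open Finset

/-- Euclidean (2-)norm of a row vector. -/
noncomputable def vnorm2 {d : ℕ} (v : Fin d → ℂ) : ℝ :=
  Real.sqrt (∑ j, ‖v j‖ ^ 2)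

/-- Mixed norm ‖·‖_{1,2}: sum of Euclidean norms of the rows. -/
noncomputable def norm12 {m d : ℕ} (B : Matrix (Fin m) (Fin d) ℂ) : ℝ :=
  ∑ i, vnorm2 (B i)

/-- Frobenius norm ‖·‖_{2,2} of a multi-vector. -/
noncomputable def norm22 {m d : ℕ} (B : Matrix (Fin m) (Fin d) ℂ) : ℝ :=
  Real.sqrt (∑ i, ∑ j, ‖B i j‖ ^ 2)

/-- Row restriction: `restrictRows B T` equals `B` on rows indexed by `T`
and is zero on all other rows. -/
def restrictRows {m d : ℕ} (B : Matrix (Fin m) (Fin d) ℂ) (T : Finset (Fin m)) :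
    Matrix (Fin m) (Fin d) ℂ :=
  fun i j => if i ∈ T then B i j else 0

theorem block_norm_comparison {m d s : ℕ}
    (D : Matrix (Fin m) (Fin d) ℂ)
    (T T' : Finset (Fin m)) (hdisj : Disjoint T T')
    (hT : T.card ≤ s) (hT' : T'.card = s)
    (hdom : ∀ i ∈ T, ∀ i' ∈ T', vnorm2 (D i) ≤ vnorm2 (D i')) :
    norm22 (restrictRows D T) ≤ (Real.sqrt s)⁻¹ * norm12 (restrictRows D T') := by
  have hsq : ∀ i, ∑ j, ‖D i j‖ ^ 2 = vnorm2 (D i) ^ 2 := fun i => by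
    unfold vnorm2
    rw [Real.sq_sqrt (Finset.sum_nonneg fun j _ => by positivity)]
  have hnn : ∀ i, 0 ≤ vnorm2 (D i) := fun i => Real.sqrt_nonneg _
  have h1 : norm12 (restrictRows D T') = ∑ i ∈ T', vnorm2 (D i) := by
    unfold norm12
    rw [← Finset.sum_subset (Finset.subset_univ T')]
    · refine Finset.sum_congr rfl fun i hi => ?_
      simp [vnorm2, restrictRows, hi]
    · intro i _ hi
      simp [vnorm2, restrictRows, hi]
  have h2 : norm22 (restrictRows D T) = Real.sqrt (∑ i ∈ T, vnorm2 (D i) ^ 2) := by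
    unfold norm22
    congr 1
    rw [← Finset.sum_subset (Finset.subset_univ T)]
    · refine Finset.sum_congr rfl fun i hi => ?_
      rw [← hsq]
      simp [restrictRows, hi]
    · intro i _ hi
      simp [restrictRows, hi]
  rw [h1, h2]
  rcases Nat.eq_zero_or_pos s with h0 | hpos
  · subst h0
    have hTe : T = ∅ := Finset.card_eq_zero.mp (Nat.le_zero.mp hT)
    simp [hTe]
  have hs : (0 : ℝ) < s := by exact_mod_cast hpos
  set S := ∑ i ∈ T', vnorm2 (D i) with hS
  have hS0 : 0 ≤ S := Finset.sum_nonneg fun i _ => hnn i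
  have hle : ∀ i ∈ T, vnorm2 (D i) ≤ S / s := fun i hi => by
    rw [le_div_iff₀ hs]
    have := Finset.card_nsmul_le_sum T' (fun k => vnorm2 (D k)) _ (hdom i hi)
    rw [hT', nsmul_eq_mul] at this
    linarith
  apply Real.sqrt_le_iff.mpr
  refine ⟨by positivity, ?_⟩
  have hsum : ∑ i ∈ T, vnorm2 (D i) ^ 2 ≤ T.card • (S / s) ^ 2 :=
    Finset.sum_le_card_nsmul _ _ _ fun i hi => pow_le_pow_left₀ (hnn i) (hle i hi) 2
  rw [nsmul_eq_mul] at hsum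
  have hc : (T.card : ℝ) ≤ s := by exact_mod_cast hT
  calc _ ≤ (T.card : ℝ) * (S / s) ^ 2 := hsum
    _ ≤ s * (S / s) ^ 2 := by gcongr
    _ = _ := by
      rw [mul_pow, inv_pow, Real.sq_sqrt hs.le]
      field_simp
end

section
/- Forward sampling identity: let γ ≥ 1, ρ ∈ [0, √2], and φ ∈ ℝ, set ξ = ρ cos φ and ζ = ρ sin φ, let θ = φ + arcsin(ρ/(γ√2)) and θ̃ = φ − arcsin(ρ/(γ√2)), let ω = γΩ, and suppose Ωℓ = π/√2. Then ωℓ(sin θ − sin θ̃) = πξ and ωℓ(cos θ − cos θ̃) = −πζ; consequently, for d̂ = (cos θ, sin θ), r̂ = (cos θ̃, sin θ̃), and r = ℓ(p₁, p₂) with p₁, p₂ ∈ ℤ, one has ω (d̂ − r̂) · r = π(−p₁ ζ + p₂ ξ). -/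
open Real

theorem forward_sampling_identity
    (γ ρ φ θ θt ω Ω ℓ ξ ζ : ℝ) (p₁ p₂ : ℤ)
    (hγ : 1 ≤ γ) (hρ0 : 0 ≤ ρ) (hρ2 : ρ ≤ Real.sqrt 2)
    (hξ : ξ = ρ * Real.cos φ) (hζ : ζ = ρ * Real.sin φ)
    (hθ : θ = φ + Real.arcsin (ρ / (γ * Real.sqrt 2)))
    (hθt : θt = φ - Real.arcsin (ρ / (γ * Real.sqrt 2)))
    (hω : ω = γ * Ω)
    (hΩℓ : Ω * ℓ = Real.pi / Real.sqrt 2) :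
    ω * ℓ * (Real.sin θ - Real.sin θt) = Real.pi * ξ ∧
    ω * ℓ * (Real.cos θ - Real.cos θt) = -Real.pi * ζ ∧
    ω * ((Real.cos θ - Real.cos θt) * (ℓ * (p₁ : ℝ))
          + (Real.sin θ - Real.sin θt) * (ℓ * (p₂ : ℝ)))
      = Real.pi * (-(p₁ : ℝ) * ζ + (p₂ : ℝ) * ξ) := by
  have hs : 0 < Real.sqrt 2 := by positivity
  have hg : 0 < γ := by linarith
  have hss : Real.sqrt 2 * Real.sqrt 2 = 2 := Real.mul_self_sqrt (by norm_num)
  have hsin : Real.sin (Real.arcsin (ρ / (γ * Real.sqrt 2))) = ρ / (γ * Real.sqrt 2) := by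
    apply Real.sin_arcsin
    · have : 0 ≤ ρ / (γ * Real.sqrt 2) := by positivity
      linarith
    · rw [div_le_one (by positivity)]
      nlinarith
  have key : ω * ℓ * (2 * (ρ / (γ * Real.sqrt 2))) = Real.pi * ρ := by
    have h1 : ω * ℓ = γ * (Real.pi / Real.sqrt 2) := by rw [hω, mul_assoc, hΩℓ]
    have h2 : γ * (Real.pi / Real.sqrt 2) * (2 * (ρ / (γ * Real.sqrt 2)))
        = Real.pi * ρ * (2 / (Real.sqrt 2 * Real.sqrt 2)) := by
      field_simp
    rw [h1, h2, hss]
    ring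
  have A : ω * ℓ * (Real.sin θ - Real.sin θt) = Real.pi * ξ := by
    rw [hθ, hθt, Real.sin_add, Real.sin_sub, hsin, hξ]
    linear_combination Real.cos φ * key
  have B : ω * ℓ * (Real.cos θ - Real.cos θt) = -Real.pi * ζ := by
    rw [hθ, hθt, Real.cos_add, Real.cos_sub, hsin, hζ]
    linear_combination (-Real.sin φ) * key
  refine ⟨A, B, ?_⟩
  linear_combination (p₁ : ℝ) * B + (p₂ : ℝ) * A
end
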